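/- Let p be a prime and let G be a finite group with center Z such that G/Z is isomorphic to a semidirect product Z_{p²} ⋊ Z_{p²}, i.e. G/Z is isomorphic either to Z_{p²} × Z_{p²} or to the nonabelian group presented by ⟨x, y | x^{p²} = y^{p²} = 1, y x = x^{p+1} y⟩. Then for every x ∈ G \ Z, the centralizer C_G(x) has order p²·|Z| or p³·|Z|. -/

import Mathlib

/-- Relators of the group `L₂ = ⟨x, y | x^(p²) = y^(p²) = 1, y x = x^(p+1) y⟩`,
where `x` is the generator `0` and `y` is the generator `1`. -/
def L2Rels (p : ℕ) : Set (FreeGroup (Fin 2)) :=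
  {FreeGroup.of 0 ^ p ^ 2, FreeGroup.of 1 ^ p ^ 2,
    FreeGroup.of 1 * FreeGroup.of 0 * (FreeGroup.of 0 ^ (p + 1) * FreeGroup.of 1)⁻¹}

/-- The nonabelian group `L₂` presented by
`⟨x, y | x^(p²) = y^(p²) = 1, y x = x^(p+1) y⟩`. -/
def L2 (p : ℕ) : Type := PresentedGroup (L2Rels p)

instance (p : ℕ) : Group (L2 p) := by unfold L2; infer_instance

/-- `x` and `y` generate a group `⟨x⟩ ⋊ ⟨y⟩`, where both cyclic factors have order `p ^ 2` and `y`
acts on `⟨x⟩` trivially modulo `p`. -/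
structure IsSplitPair (p : ℕ) {Q : Type*} [Group Q] (x y : Q) : Prop where
  orderOf_left : orderOf x = p ^ 2
  right_pow : y ^ p ^ 2 = 1
  semiconj : ∃ c : ℕ, SemiconjBy y x (x ^ (c * p + 1))
  exists_proj : ∃ φ : Q →* Multiplicative (ZMod (p ^ 2)), φ x = 1 ∧ φ y = Multiplicative.ofAdd 1
  exists_eq : ∀ w : Q, ∃ a b : ℕ, w = x ^ a * y ^ b

theorem mul_add_one_pow_modEq (p c : ℕ) : (c * p + 1) ^ p ≡ 1 [MOD p ^ 2] := by
  have h := dvd_sub_pow_of_dvd_sub (R := ℤ) (p := p) (a := c * p + 1) (b := 1)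
    ⟨c, by ring⟩ 1
  rw [pow_one, one_pow] at h
  refine ((Nat.modEq_iff_dvd).2 ?_).symm
  exact_mod_cast h

theorem SemiconjBy.pow_left_pow {Q : Type*} [Group Q] {x y : Q} {m : ℕ}
    (h : SemiconjBy y x (x ^ m)) (n : ℕ) : SemiconjBy (y ^ n) x (x ^ m ^ n) := by
  induction n with
  | zero => simp
  | succ n ih =>
    rw [pow_succ', pow_succ', pow_mul]
    exact (h.pow_right _).mul_left ih

theorem Multiplicative.ofAdd_one_pow_eq_one_iff {n k : ℕ} :
    (Multiplicative.ofAdd (1 : ZMod n)) ^ k = 1 ↔ n ∣ k := by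
  rw [← ofAdd_nsmul, ofAdd_eq_one, nsmul_one, ZMod.natCast_eq_zero_iff]

namespace IsSplitPair

variable {p : ℕ} {Q : Type*} [Group Q] {x y : Q}

theorem commute_right_pow (h : IsSplitPair p x y) : Commute (y ^ p) x := by
  obtain ⟨c, hc⟩ := h.semiconj
  have h1 := hc.pow_left_pow p
  have h2 : x ^ (c * p + 1) ^ p = x := by
    conv_rhs => rw [← pow_one x]
    rw [pow_eq_pow_iff_modEq, h.orderOf_left]
    exact mul_add_one_pow_modEq p c
  rwa [h2] at h1

theorem commute_left_pow (h : IsSplitPair p x y) : Commute (x ^ p) y := by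
  obtain ⟨c, hc⟩ := h.semiconj
  have h1 := hc.pow_right p
  have h2 : (x ^ (c * p + 1)) ^ p = x ^ p := by
    rw [← pow_mul, pow_eq_pow_iff_modEq, h.orderOf_left]
    refine (Nat.modEq_iff_dvd.2 ⟨c, ?_⟩).symm
    push_cast
    ring
  rw [h2] at h1
  exact Commute.symm h1

theorem card_eq (h : IsSplitPair p x y) : Nat.card Q = p ^ 4 := by
  obtain ⟨φ, hx, hy⟩ := h.exists_proj
  have hker : φ.ker = Subgroup.zpowers x := by
    apply le_antisymm
    · intro w hw
      obtain ⟨a, b, rfl⟩ := h.exists_eq w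
      rw [MonoidHom.mem_ker, map_mul, map_pow, map_pow, hx, hy, one_pow, one_mul,
        Multiplicative.ofAdd_one_pow_eq_one_iff] at hw
      obtain ⟨k, rfl⟩ := hw
      rw [pow_mul, h.right_pow, one_pow, mul_one]
      exact Subgroup.npow_mem_zpowers x a
    · rw [Subgroup.zpowers_le]
      exact hx
  have hsurj : Function.Surjective φ := fun t => by
    obtain ⟨k, hk⟩ := ZMod.intCast_surjective t.toAdd
    refine ⟨y ^ k, ?_⟩
    rw [map_zpow, hy, ← ofAdd_zsmul, zsmul_one, hk, ofAdd_toAdd]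
  rw [Subgroup.card_eq_card_quotient_mul_card_subgroup φ.ker,
    Nat.card_congr (QuotientGroup.quotientKerEquivOfSurjective φ hsurj).toEquiv, hker,
    Nat.card_zpowers, h.orderOf_left, Nat.card_congr Multiplicative.toAdd, Nat.card_zmod]
  ring

theorem exists_eq_of_pow_eq_one (h : IsSplitPair p x y) (hp : p.Prime) {w : Q} (hw : w ^ p = 1) :
    ∃ a b : ℕ, w = (x ^ p) ^ a * (y ^ p) ^ b := by
  obtain ⟨φ, hx, hy⟩ := h.exists_proj
  obtain ⟨a, b, rfl⟩ := h.exists_eq w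
  have hb : p ∣ b := by
    have h1 : φ ((x ^ a * y ^ b) ^ p) = 1 := by rw [hw, map_one]
    rw [map_pow, map_mul, map_pow, map_pow, hx, hy, one_pow, one_mul, ← pow_mul,
      Multiplicative.ofAdd_one_pow_eq_one_iff, pow_two] at h1
    exact Nat.dvd_of_mul_dvd_mul_right hp.pos h1
  obtain ⟨b, rfl⟩ := hb
  have hcomm : Commute (x ^ a) (y ^ (p * b)) := by
    rw [pow_mul]
    exact ((h.commute_right_pow.pow_left b).pow_right a).symm
  have ha : p ∣ a := by
    rw [hcomm.mul_pow, ← pow_mul, ← pow_mul, show p * b * p = p ^ 2 * b by ring, pow_mul y,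
      h.right_pow, one_pow, mul_one, ← orderOf_dvd_iff_pow_eq_one, h.orderOf_left, pow_two] at hw
    exact Nat.dvd_of_mul_dvd_mul_right hp.pos hw
  obtain ⟨a, rfl⟩ := ha
  exact ⟨a, b, by rw [pow_mul, pow_mul]⟩

theorem card_ne_of_mem (h : IsSplitPair p x y) (hp : p.Prime) {H : Subgroup Q}
    (hx : x ^ p ∈ H) (hy : y ^ p ∈ H) : Nat.card H ≠ p := by
  intro hH
  have := Fact.mk hp
  have hnd : ¬ p ^ 2 ∣ p := fun hd => by
    have := Nat.le_of_dvd hp.pos hd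
    nlinarith [hp.two_le]
  have hx1 : (⟨x ^ p, hx⟩ : H) ≠ 1 := fun h1 => by
    rw [Subgroup.mk_eq_one, ← orderOf_dvd_iff_pow_eq_one, h.orderOf_left] at h1
    exact hnd h1
  obtain ⟨k, hk⟩ := Subgroup.mem_zpowers_iff.1
    (mem_zpowers_of_prime_card hH hx1 (g' := ⟨y ^ p, hy⟩))
  obtain ⟨φ, hφx, hφy⟩ := h.exists_proj
  have h1 := congrArg (fun t : H => φ t) hk
  simp only [Subgroup.coe_zpow, map_zpow, map_pow, hφx, hφy, one_pow, one_zpow] at h1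
  exact hnd (Multiplicative.ofAdd_one_pow_eq_one_iff.1 h1.symm)

end IsSplitPair

open scoped commutatorElement in
/-- If `X ^ n` is central and `X` commutes with `Y` modulo the center, then `X` commutes with
`Y ^ n`. -/
theorem commute_pow_of_commutator_mem_center {G : Type*} [Group G] {X Y : G} {n : ℕ}
    (hXY : ⁅X, Y⁆ ∈ Subgroup.center G) (hX : X ^ n ∈ Subgroup.center G) :
    Commute X (Y ^ n) := by
  have hc : ∀ g, Commute ⁅X, Y⁆ g := fun g => (Subgroup.mem_center_iff.1 hXY g).symm
  have hX' : X * Y * X⁻¹ = ⁅X, Y⁆ * Y := by rw [commutatorElement_def]; group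
  have hY' : Y * X * Y⁻¹ = ⁅X, Y⁆⁻¹ * X := by rw [commutatorElement_def]; group
  have h1 : X ^ n = (⁅X, Y⁆⁻¹) ^ n * X ^ n := by
    rw [← (hc X).inv_left.mul_pow, ← hY', conj_pow, Subgroup.mem_center_iff.1 hX Y,
      mul_inv_cancel_right]
  have h2 : ⁅X, Y⁆ ^ n = 1 := by
    rw [right_eq_mul, inv_pow, inv_eq_one] at h1
    exact h1
  have h3 : X * Y ^ n * X⁻¹ = Y ^ n := by
    rw [← conj_pow, hX', (hc Y).mul_pow, h2, one_mul]
  exact mul_inv_eq_iff_eq_mul.1 h3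

theorem Subgroup.card_map_mul_card_ker {G Q : Type*} [Group G] [Group Q] (f : G →* Q)
    {H : Subgroup G} (hH : f.ker ≤ H) : Nat.card (H.map f) * Nat.card f.ker = Nat.card H := by
  have h1 := Subgroup.card_mul_index (f.ker.subgroupOf H)
  rw [Nat.card_congr (Subgroup.subgroupOfEquivOfLe hH).toEquiv] at h1
  rw [mul_comm, ← h1, ← Subgroup.relIndex, Subgroup.relIndex_ker]

theorem IsSplitPair.card_centralizer_eq {p : ℕ} (hp : p.Prime) {G Q : Type*} [Group G] [Group Q]
    {x y : Q} (h : IsSplitPair p x y) (f : G →* Q) (hf : Function.Surjective f)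
    (hker : f.ker = Subgroup.center G) {g : G} (hg : g ∉ Subgroup.center G) :
    Nat.card (Subgroup.centralizer {g}) = p ^ 2 * Nat.card (Subgroup.center G) ∨
      Nat.card (Subgroup.centralizer {g}) = p ^ 3 * Nat.card (Subgroup.center G) := by
  have hle : f.ker ≤ Subgroup.centralizer {g} := by
    rw [hker]
    exact Subgroup.center_le_centralizer _
  have hfg : f g ∈ (Subgroup.centralizer {g}).map f :=
    Subgroup.mem_map_of_mem f (Subgroup.mem_centralizer_singleton_iff.2 rfl)
  have hfg1 : f g ≠ 1 := fun h1 => hg (hker ▸ f.mem_ker.2 h1)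
  rw [← Subgroup.card_map_mul_card_ker f hle, hker]
  obtain ⟨k, hk4, hk⟩ := (Nat.dvd_prime_pow hp).1
    (h.card_eq ▸ ((Subgroup.centralizer {g}).map f).card_subgroup_dvd_card)
  rw [hk]
  have hk0 : k ≠ 0 := by
    rintro rfl
    rw [pow_zero, Subgroup.card_eq_one] at hk
    rw [hk] at hfg
    exact hfg1 (Subgroup.mem_bot.1 hfg)
  have hkne4 : k ≠ 4 := by
    rintro rfl
    have : Finite Q := Nat.finite_of_card_ne_zero (h.card_eq ▸ (pow_pos hp.pos 4).ne')
    have htop : (Subgroup.centralizer {g}).map f = ⊤ :=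
      Subgroup.eq_top_of_card_eq _ (hk.trans h.card_eq.symm)
    have h2 := congrArg (Subgroup.comap f) htop
    rw [Subgroup.comap_map_eq_self hle, Subgroup.comap_top,
      Subgroup.centralizer_eq_top_iff_subset] at h2
    exact hg (h2 rfl)
  have hk1 : k ≠ 1 := by
    rintro rfl
    rw [pow_one] at hk
    have hfgp : f g ^ p = 1 := by
      have := pow_card_eq_one' (x := (⟨f g, hfg⟩ : (Subgroup.centralizer {g}).map f))
      rw [hk] at this
      exact congrArg Subtype.val this
    obtain ⟨a, b, hab⟩ := h.exists_eq_of_pow_eq_one hp hfgp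
    obtain ⟨X, rfl⟩ := hf x
    obtain ⟨Y, rfl⟩ := hf y
    have hcomm : Commute (X ^ p) (Y ^ p) := by
      refine commute_pow_of_commutator_mem_center ?_ ?_
      · rw [← hker, MonoidHom.mem_ker, map_commutatorElement f, map_pow,
          commutatorElement_eq_one_iff_commute]
        exact h.commute_left_pow
      · rw [← hker, MonoidHom.mem_ker, ← pow_mul, ← pow_two, map_pow, ← h.orderOf_left,
          pow_orderOf_eq_one]
    obtain ⟨z, hz, rfl⟩ : ∃ z ∈ Subgroup.center G, g = (X ^ p) ^ a * (Y ^ p) ^ b * z := by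
      refine ⟨((X ^ p) ^ a * (Y ^ p) ^ b)⁻¹ * g, ?_, by group⟩
      rw [← hker, MonoidHom.mem_ker, map_mul, map_inv, hab]
      simp
    have hzc : ∀ t, Commute t z := Subgroup.mem_center_iff.1 hz
    refine h.card_ne_of_mem hp ?_ ?_ hk
    · rw [← map_pow]
      refine Subgroup.mem_map_of_mem f (Subgroup.mem_centralizer_singleton_iff.2 ?_)
      exact (((Commute.refl _).pow_right a).mul_right (hcomm.pow_right b)).mul_right (hzc _)
    · rw [← map_pow]
      refine Subgroup.mem_map_of_mem f (Subgroup.mem_centralizer_singleton_iff.2 ?_)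
      exact ((hcomm.symm.pow_right a).mul_right ((Commute.refl _).pow_right b)).mul_right (hzc _)
  have : k = 2 ∨ k = 3 := by lia
  rcases this with rfl | rfl
  · exact Or.inl rfl
  · exact Or.inr rfl

theorem isSplitPair_prod {p : ℕ} (hp : p.Prime) :
    IsSplitPair p ((Multiplicative.ofAdd 1, 1) :
      Multiplicative (ZMod (p ^ 2)) × Multiplicative (ZMod (p ^ 2))) (1, Multiplicative.ofAdd 1) where
  orderOf_left := by
    rw [Prod.orderOf_mk, orderOf_one, orderOf_ofAdd_eq_addOrderOf, ZMod.addOrderOf_one,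
      Nat.lcm_one_right]
  right_pow := Prod.ext (one_pow _) (Multiplicative.ofAdd_one_pow_eq_one_iff.2 dvd_rfl)
  semiconj := ⟨0, by rw [zero_mul, zero_add, pow_one]; exact Commute.all _ _⟩
  exists_proj := ⟨MonoidHom.snd _ _, rfl, rfl⟩
  exists_eq := fun w => by
    have : NeZero (p ^ 2) := ⟨(pow_pos hp.pos 2).ne'⟩
    obtain ⟨a, ha⟩ := ZMod.natCast_zmod_surjective w.1.toAdd
    obtain ⟨b, hb⟩ := ZMod.natCast_zmod_surjective w.2.toAdd
    refine ⟨a, b, Prod.ext ?_ ?_⟩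
    · rw [Prod.fst_mul, Prod.pow_fst, Prod.pow_fst, one_pow, mul_one, ← ofAdd_nsmul, nsmul_one, ha,
        ofAdd_toAdd]
    · rw [Prod.snd_mul, Prod.pow_snd, Prod.pow_snd, one_pow, one_mul, ← ofAdd_nsmul, nsmul_one, hb,
        ofAdd_toAdd]

theorem Equiv.addRight_pow_apply {A : Type*} [AddGroup A] (a t : A) (n : ℕ) :
    (Equiv.addRight a ^ n) t = t + n • a := by
  induction n with
  | zero => simp
  | succ n ih =>
    rw [pow_succ', Equiv.Perm.mul_apply, ih, succ_nsmul, ← add_assoc]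
    rfl

namespace L2

/-- The generator `x` of `L2 p`. -/
def x (p : ℕ) : L2 p := PresentedGroup.of (rels := L2Rels p) 0

/-- The generator `y` of `L2 p`. -/
def y (p : ℕ) : L2 p := PresentedGroup.of (rels := L2Rels p) 1

theorem x_pow (p : ℕ) : x p ^ p ^ 2 = 1 :=
  PresentedGroup.one_of_mem (rels := L2Rels p) (x := FreeGroup.of 0 ^ p ^ 2) (by simp [L2Rels])

theorem y_pow (p : ℕ) : y p ^ p ^ 2 = 1 :=
  PresentedGroup.one_of_mem (rels := L2Rels p) (x := FreeGroup.of 1 ^ p ^ 2) (by simp [L2Rels])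

theorem semiconjBy (p : ℕ) : SemiconjBy (y p) (x p) (x p ^ (p + 1)) :=
  mul_inv_eq_one.1 (PresentedGroup.one_of_mem (rels := L2Rels p)
    (x := FreeGroup.of 1 * FreeGroup.of 0 * (FreeGroup.of 0 ^ (p + 1) * FreeGroup.of 1)⁻¹)
    (by simp [L2Rels]))

theorem closure_eq_top (p : ℕ) : Subgroup.closure {x p, y p} = ⊤ := by
  have h := PresentedGroup.closure_range_of (L2Rels p)
  have hr : Set.range (PresentedGroup.of (rels := L2Rels p)) = {x p, y p} := by
    ext w
    simp only [Set.mem_range, Fin.exists_fin_two, eq_comm (b := w)]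
    rfl
  rwa [hr] at h

theorem exists_lift (p : ℕ) {H : Type*} [Group H] (a b : H) (ha : a ^ p ^ 2 = 1)
    (hb : b ^ p ^ 2 = 1) (hab : SemiconjBy b a (a ^ (p + 1))) :
    ∃ φ : L2 p →* H, φ (x p) = a ∧ φ (y p) = b := by
  have hrel : ∀ r ∈ L2Rels p, FreeGroup.lift ![a, b] r = 1 := by
    rintro r (rfl | rfl | rfl)
    · simpa using ha
    · simpa using hb
    · rw [map_mul, map_inv, mul_inv_eq_one]
      simpa using hab.eq
  exact ⟨PresentedGroup.toGroup hrel, PresentedGroup.toGroup.of hrel, PresentedGroup.toGroup.of hrel⟩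

theorem exists_eq {p : ℕ} (hp : p.Prime) (w : L2 p) : ∃ a b : ℕ, w = x p ^ a * y p ^ b := by
  have hmul : ∀ a b c d : ℕ, ∃ k l : ℕ,
      x p ^ a * y p ^ b * (x p ^ c * y p ^ d) = x p ^ k * y p ^ l := by
    intro a b c d
    refine ⟨a + (p + 1) ^ b * c, b + d, ?_⟩
    have h := (((semiconjBy p).pow_left_pow b).pow_right c).eq
    rw [← pow_mul] at h
    rw [pow_add, pow_add, mul_assoc, ← mul_assoc (y p ^ b), h]
    simp only [mul_assoc]
  have hinv : ∀ {u : L2 p}, u ^ p ^ 2 = 1 → ∀ a : ℕ, (u ^ a)⁻¹ = u ^ ((p ^ 2 - 1) * a) := by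
    intro u hu a
    refine inv_eq_of_mul_eq_one_right ?_
    rw [← pow_add, ← one_add_mul, Nat.add_sub_cancel' (Nat.one_le_pow _ _ hp.pos), pow_mul, hu,
      one_pow]
  have hw : w ∈ Subgroup.closure {x p, y p} := closure_eq_top p ▸ Subgroup.mem_top w
  induction hw using Subgroup.closure_induction with
  | mem w hw =>
    rcases hw with rfl | rfl
    · exact ⟨1, 0, by simp⟩
    · exact ⟨0, 1, by simp⟩
  | one => exact ⟨0, 0, by simp⟩
  | mul u v _ _ hu hv =>
    obtain ⟨a, b, rfl⟩ := hu
    obtain ⟨c, d, rfl⟩ := hv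
    exact hmul a b c d
  | inv u _ hu =>
    obtain ⟨a, b, rfl⟩ := hu
    rw [mul_inv_rev, hinv (x_pow p), hinv (y_pow p)]
    simpa using hmul 0 ((p ^ 2 - 1) * b) ((p ^ 2 - 1) * a) 0

theorem orderOf_x (p : ℕ) : orderOf (x p) = p ^ 2 := by
  refine Nat.dvd_antisymm (orderOf_dvd_of_pow_eq_one (x_pow p)) ?_
  have hcop : (p + 1).Coprime (p ^ 2) := Nat.Coprime.pow_right 2 (by simp)
  set u : (ZMod (p ^ 2))ˣ := ZMod.unitOfCoprime (p + 1) hcop with hu_def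
  have hu : u ^ p = 1 := by
    have h := (ZMod.natCast_eq_natCast_iff _ _ _).2 (mul_add_one_pow_modEq p 1)
    ext
    rw [Units.val_pow_eq_pow_val, hu_def, ZMod.coe_unitOfCoprime]
    simpa using h
  obtain ⟨φ, hx, -⟩ := exists_lift p (Equiv.addRight (1 : ZMod (p ^ 2)))
    (MulAction.toPermHom (ZMod (p ^ 2))ˣ (ZMod (p ^ 2)) u)
    (Equiv.ext fun t => by
      rw [Equiv.addRight_pow_apply, nsmul_one, ZMod.natCast_self, add_zero, Equiv.Perm.one_apply])
    (by
      have hu2 : u ^ p ^ 2 = 1 := by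
        rw [← one_pow p, ← hu, ← pow_mul, ← pow_two]
      rw [← map_pow, hu2, map_one])
    (Equiv.ext fun t => by
      simp only [Equiv.Perm.mul_apply, Equiv.addRight_pow_apply, Equiv.coe_addRight,
        MulAction.toPermHom_apply, MulAction.toPerm_apply, Units.smul_def, smul_eq_mul, nsmul_one,
        hu_def, ZMod.coe_unitOfCoprime]
      rw [mul_add, mul_one])
  have h := congrArg (fun σ : Equiv.Perm (ZMod (p ^ 2)) => σ 0)
    (congrArg φ (pow_orderOf_eq_one (x p)))
  simp only [map_pow, hx, Equiv.addRight_pow_apply, map_one, Equiv.Perm.one_apply,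
    zero_add, nsmul_one] at h
  exact (ZMod.natCast_eq_zero_iff _ _).1 h

theorem isSplitPair {p : ℕ} (hp : p.Prime) : IsSplitPair p (x p) (y p) where
  orderOf_left := orderOf_x p
  right_pow := y_pow p
  semiconj := ⟨1, by rw [one_mul]; exact semiconjBy p⟩
  exists_proj := exists_lift p 1 _ (one_pow _)
    (Multiplicative.ofAdd_one_pow_eq_one_iff.2 dvd_rfl) (by simp)
  exists_eq := exists_eq hp

end L2

/-- If `G` is a finite group with `G/Z(G)` isomorphic to a semidirect product
`Z_(p²) ⋊ Z_(p²)` (either `Z_(p²) × Z_(p²)` or the nonabelian group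
`⟨x, y | x^(p²) = y^(p²) = 1, y x = x^(p+1) y⟩`), then for every noncentral `x ∈ G`
the centralizer `C_G(x)` has order `p²·|Z|` or `p³·|Z|`. -/
theorem card_centralizer_eq {G : Type*} [Group G] [Fintype G] (p : ℕ) (hp : p.Prime)
    (hiso : Nonempty ((G ⧸ Subgroup.center G) ≃*
        (Multiplicative (ZMod (p ^ 2)) × Multiplicative (ZMod (p ^ 2)))) ∨
      Nonempty ((G ⧸ Subgroup.center G) ≃* L2 p)) :
    ∀ x : G, x ∉ Subgroup.center G →
      Nat.card (Subgroup.centralizer {x}) = p ^ 2 * Nat.card (Subgroup.center G) ∨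
      Nat.card (Subgroup.centralizer {x}) = p ^ 3 * Nat.card (Subgroup.center G) := by
  intro x hx
  have hker {Q : Type} [Group Q] (e : (G ⧸ Subgroup.center G) ≃* Q) :
      ((e : (G ⧸ Subgroup.center G) →* Q).comp (QuotientGroup.mk' (Subgroup.center G))).ker =
        Subgroup.center G := by
    rw [MonoidHom.ker_mulEquiv_comp, QuotientGroup.ker_mk']
  rcases hiso with ⟨⟨e⟩⟩ | ⟨⟨e⟩⟩
  · exact (isSplitPair_prod hp).card_centralizer_eq hp _
      (e.surjective.comp (QuotientGroup.mk'_surjective _)) (hker e) hx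
  · exact (L2.isSplitPair hp).card_centralizer_eq hp _
      (e.surjective.comp (QuotientGroup.mk'_surjective _)) (hker e) hx
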